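/- arXiv:math/9801078 — 2 statements merged into one kernel-verified Lean document; each statement's English description precedes it below -/
import Mathlib

section
/- Let κ be a regular uncountable cardinal and let A ⊇ κ be a set. For a function F : A^{<ω} → A let C_F = {x ∈ 𝒫_κ A : x ∩ κ ∈ κ and F(s) ∈ x for every finite sequence s of elements of x}. Then: (1) for every F : A^{<ω} → A, the set C_F is closed unbounded in 𝒫_κ A; and (2) every closed unbounded set C ⊆ 𝒫_κ A contains C_F for some F : A^{<ω} → A. Consequently, a set S ⊆ 𝒫_κ A is stationary if and only if for every F : A^{<ω} → A there exists x ∈ S with x ∩ κ ∈ κ that is closed under F. -/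
open Cardinal Set

namespace PKL

/-- The order type of a set of ordinals (as an ordinal one universe up). -/
noncomputable def otp (s : Set Ordinal.{0}) : Ordinal.{1} :=
  Ordinal.type ((· < ·) : s → s → Prop)

/-- `𝒫_κ A` : all subsets of `A` of cardinality `< κ`. -/
def PSet (κ : Cardinal.{0}) (A : Set Ordinal.{0}) : Set (Set Ordinal.{0}) :=
  {x | x ⊆ A ∧ #x < Cardinal.lift.{1} κ}

/-- `C` is closed unbounded in `𝒫_κ A`: it is `⊆`-cofinal and closed under
unions of `⊆`-increasing chains of length `< κ`. -/
def IsClub (κ : Cardinal.{0}) (A : Set Ordinal.{0}) (C : Set (Set Ordinal.{0})) : Prop :=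
  C ⊆ PSet κ A ∧
  (∀ x ∈ PSet κ A, ∃ y ∈ C, x ⊆ y) ∧
  (∀ δ : Ordinal.{0}, 0 < δ → δ < κ.ord → ∀ f : Ordinal.{0} → Set Ordinal.{0},
    (∀ α β, α ≤ β → β < δ → f α ⊆ f β) →
    (∀ α < δ, f α ∈ C) → (⋃ α ∈ Set.Iio δ, f α) ∈ C)

/-- `S` is stationary in `𝒫_κ A`: it meets every closed unbounded set. -/
def IsStationary (κ : Cardinal.{0}) (A : Set Ordinal.{0}) (S : Set (Set Ordinal.{0})) : Prop :=
  ∀ C, IsClub κ A C → (S ∩ C).Nonempty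

/-- `κ⁺` as an ordinal: the initial ordinal of the successor cardinal of `κ`. -/
noncomputable def succOrd (κ : Cardinal.{0}) : Ordinal.{0} := (Order.succ κ).ord

/-- The ordinal `δ` is a limit cardinal. -/
def IsLimitCardOrd (δ : Ordinal.{0}) : Prop :=
  δ.card.ord = δ ∧ ℵ₀ ≤ δ.card ∧ ∀ c < δ.card, Order.succ c < δ.card

/-- The ordinal `δ` is an inaccessible cardinal. -/
def IsInaccessibleOrd (δ : Ordinal.{0}) : Prop :=
  δ.card.ord = δ ∧ δ.card.IsInaccessible

/-- `E₀ = {x ∈ 𝒫_κ κ⁺ : κ_x is a limit cardinal and cf κ_x = cf λ_x}`. -/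
noncomputable def E0 (κ : Cardinal.{0}) : Set (Set Ordinal.{0}) :=
  {x | x ∈ PSet κ (Iio (succOrd κ)) ∧ ∃ δ : Ordinal.{0},
    x ∩ Iio κ.ord = Iio δ ∧ IsLimitCardOrd δ ∧ Cardinal.lift.{1} δ.cof = (otp x).cof}

/-- `E₁ = {x ∈ 𝒫_κ κ⁺ : κ_x is inaccessible and λ_x = κ_x⁺}`. -/
noncomputable def E1 (κ : Cardinal.{0}) : Set (Set Ordinal.{0}) :=
  {x | x ∈ PSet κ (Iio (succOrd κ)) ∧ ∃ δ : Ordinal.{0},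
    x ∩ Iio κ.ord = Iio δ ∧ IsInaccessibleOrd δ ∧ otp x = Ordinal.lift.{1} (succOrd δ.card)}

/-- A model `(M, π, ρ)`: `M ∈ 𝒫_κ κ⁺`, `M ∩ κ` is the ordinal `κM`, the order
type of `M` is at most `|κM|⁺`; for `α ∈ M \ κ`, `π_α` maps `M ∩ α` into `M ∩ α`
and maps `κM` onto `M ∩ α`; for `α ∈ M \ κ` and `β < κM`, `β ≤ ρ_α β < κM`.
(`π` and `ρ` are coded as total functions; only their values on the domains
described above are meaningful.) -/
structure OModel (κ : Cardinal.{0}) where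
  M : Set Ordinal.{0}
  κM : Ordinal.{0}
  π : Ordinal.{0} → Ordinal.{0} → Ordinal.{0}
  ρ : Ordinal.{0} → Ordinal.{0} → Ordinal.{0}
  sub : M ⊆ Iio (succOrd κ)
  card_lt : #M < Cardinal.lift.{1} κ
  inter : M ∩ Iio κ.ord = Iio κM
  otp_le : otp M ≤ Ordinal.lift.{1} ((Order.succ κM.card).ord)
  π_mem : ∀ α ∈ M, κ.ord ≤ α → ∀ β ∈ M, β < α → π α β ∈ M ∧ π α β < α
  π_onto : ∀ α ∈ M, κ.ord ≤ α → ∀ γ ∈ M, γ < α → ∃ β < κM, π α β = γ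
  ρ_spec : ∀ α ∈ M, κ.ord ≤ α → ∀ β < κM, β ≤ ρ α β ∧ ρ α β < κM

/-- Two models are coherent: their `π`'s and `ρ`'s agree wherever both are defined. -/
def Coherent {κ : Cardinal.{0}} (A B : OModel κ) : Prop :=
  (∀ α ∈ A.M ∩ B.M, κ.ord ≤ α → ∀ β ∈ A.M ∩ B.M, β < α → A.π α β = B.π α β) ∧
  (∀ α ∈ A.M ∩ B.M, κ.ord ≤ α → ∀ β : Ordinal.{0}, β < A.κM → β < B.κM →
    A.ρ α β = B.ρ α β)

/-- `A` is a submodel of `B`: `A.M ⊆ B.M` and `π^A ⊆ π^B`, `ρ^A ⊆ ρ^B`. -/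
def Submodel {κ : Cardinal.{0}} (A B : OModel κ) : Prop :=
  A.M ⊆ B.M ∧
  (∀ α ∈ A.M, κ.ord ≤ α → ∀ β ∈ A.M, β < α → A.π α β = B.π α β) ∧
  (∀ α ∈ A.M, κ.ord ≤ α → ∀ β < A.κM, A.ρ α β = B.ρ α β)

/-- A condition in `Q(S)` (for `S` a stationary subset of `E₀`),
Definition 3.3 of the paper. -/
structure IsCondition (κ : Cardinal.{0}) (S : Set (Set Ordinal.{0})) (A : OModel κ) :
    Prop where
  /-- `M` is `ω`-closed. -/
  omega_closed : ∀ γ : Ordinal.{0}, γ.cof = ℵ₀ → sSup (A.M ∩ Iio γ) = γ → γ ∈ A.M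
  /-- Clause (ii) of Definition 3.3. -/
  sup_prop : ∀ α ∈ A.M, κ.ord ≤ α → ∀ β < A.κM, ∀ γ : Ordinal.{0}, A.κM ≤ γ → γ < α →
    ∀ f : ℕ → Ordinal.{0}, (∀ n, f n < β) → γ = ⨆ n, A.π α (f n) →
    ∃ ζ < A.ρ α β, γ = A.π α ζ
  /-- Clause (iii): for every submodel `a ∈ E₁`, `S ∩ 𝒫_{κ_a} a` is stationary
  in `𝒫_{κ_a} a`. -/
  reflect : ∀ a : OModel κ, Submodel a A → a.M ∈ E1 κ →
    IsStationary a.κM.card a.M (S ∩ PSet a.κM.card a.M)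

/-- `N` is a stronger condition than `M`. -/
def Stronger {κ : Cardinal.{0}} (N M : OModel κ) : Prop :=
  Submodel M N ∧ #M.M < Cardinal.lift.{1} N.κM.card

/-- `C_F`: the collection of `x ∈ 𝒫_κ A` such that `x ∩ κ ∈ κ` and `x` is
closed under `F` (acting on finite sequences from `x`). -/
def CF (κ : Cardinal.{0}) (A : Set Ordinal.{0}) (F : List Ordinal.{0} → Ordinal.{0}) :
    Set (Set Ordinal.{0}) :=
  {x | x ∈ PSet κ A ∧ (∃ δ : Ordinal.{0}, δ < κ.ord ∧ x ∩ Iio κ.ord = Iio δ) ∧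
    ∀ s : List Ordinal.{0}, (∀ o ∈ s, o ∈ x) → F s ∈ x}

/-- Every set of ordinals of size `< κ` is enumerated in order type its cardinality. -/
lemma exists_image_Iio_ord_eq {κ : Cardinal.{0}} {z : Set Ordinal.{0}}
    (hz : #z < Cardinal.lift.{1} κ) :
    ∃ μ < κ, #z = Cardinal.lift.{1} μ ∧ ∃ g : Ordinal.{0} → Ordinal.{0},
      g '' Iio μ.ord = z := by
  obtain ⟨μ, hμ, hμz⟩ := Cardinal.lt_lift_iff.1 hz
  refine ⟨μ, hμ, hμz.symm, ?_⟩
  have hc : #(Iio μ.ord) = #z := by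
    rw [Cardinal.mk_Iio_ordinal, Cardinal.card_ord, hμz]
  obtain ⟨e⟩ := Cardinal.eq.1 hc
  refine ⟨fun a => if h : a ∈ Iio μ.ord then e ⟨a, h⟩ else 0, ?_⟩
  ext b
  constructor
  · rintro ⟨a, ha, rfl⟩
    simp only [ha, dite_true]
    exact (e ⟨a, ha⟩).2
  · intro hb
    refine ⟨e.symm ⟨b, hb⟩, (e.symm ⟨b, hb⟩).2, ?_⟩
    simp

/-- A set of size `< κ` meets `κ` in an ordinal below `κ` iff its trace on `κ` is transitive. -/
lemma exists_inter_Iio_ord_eq_iff {κ : Cardinal.{0}} {x : Set Ordinal.{0}}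
    (hx : #x < Cardinal.lift.{1} κ) :
    (∃ δ : Ordinal.{0}, δ < κ.ord ∧ x ∩ Iio κ.ord = Iio δ) ↔
      ∀ b ∈ x, b < κ.ord → Iio b ⊆ x := by
  constructor
  · rintro ⟨δ, -, h⟩ b hb hbκ a ha
    have hbδ : b ∈ Iio δ := h ▸ ⟨hb, hbκ⟩
    have haδ : a ∈ Iio δ := mem_Iio.2 (lt_trans (mem_Iio.1 ha) (mem_Iio.1 hbδ))
    rw [← h] at haδ
    exact haδ.1
  · intro h
    have hne : ∃ δ < κ.ord, δ ∉ x := by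
      by_contra! hcon
      have hle : #(Iio κ.ord) ≤ #x := Cardinal.mk_le_mk_of_subset fun a ha => hcon a ha
      rw [Cardinal.mk_Iio_ordinal, Cardinal.card_ord] at hle
      exact absurd hx (not_lt.2 hle)
    obtain ⟨δ, ⟨hδ, hδx⟩, hmin⟩ := WellFounded.has_min (wellFounded_lt (α := Ordinal.{0}))
      {δ | δ < κ.ord ∧ δ ∉ x} hne
    refine ⟨δ, hδ, Set.ext fun a => ⟨fun ha => ?_, fun ha => ⟨?_, lt_trans ha hδ⟩⟩⟩
    · by_contra hcon
      rcases (not_lt.1 (mt mem_Iio.2 hcon)).eq_or_lt with rfl | hlt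
      · exact hδx ha.1
      · exact hδx (h a ha.1 ha.2 hlt)
    · by_contra hcon
      exact hmin a ⟨lt_trans ha hδ, hcon⟩ ha

/-- If every element of a list lies in a directed union, some member contains all of them. -/
lemma exists_forall_mem_of_forall_mem_iUnion {ι α : Type*} [Nonempty ι] {f : ι → Set α}
    (hf : Directed (· ⊆ ·) f) (s : List α) (hs : ∀ o ∈ s, o ∈ ⋃ i, f i) :
    ∃ i, ∀ o ∈ s, o ∈ f i := by
  classical
  obtain ⟨i, hi⟩ := hf.exists_mem_subset_of_finset_subset_biUnion (s := s.toFinset)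
    fun o ho => hs o (List.mem_toFinset.1 ho)
  exact ⟨i, fun o ho => hi (List.mem_toFinset.2 ho)⟩

/-- One step of closing off under `F` and under taking predecessors of ordinals below `κ`. -/
def closureStep (κ : Cardinal.{0}) (F : List Ordinal.{0} → Ordinal.{0}) (x : Set Ordinal.{0}) :
    Set Ordinal.{0} :=
  x ∪ ((range fun s : List x => F (s.map (↑))) ∪ ⋃ b : ↑(x ∩ Iio κ.ord), Iio (b : Ordinal.{0}))

lemma closureStep_mem_PSet {κ : Cardinal.{0}} (hreg : κ.IsRegular) (hunc : ℵ₀ < κ)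
    {A : Set Ordinal.{0}} (hA : Iio κ.ord ⊆ A) {F : List Ordinal.{0} → Ordinal.{0}}
    (hF : ∀ s : List Ordinal.{0}, (∀ o ∈ s, o ∈ A) → F s ∈ A)
    {x : Set Ordinal.{0}} (hx : x ∈ PSet κ A) : closureStep κ F x ∈ PSet κ A := by
  have hregl : (Cardinal.lift.{1} κ).IsRegular := hreg.lift
  have huncl : ℵ₀ < Cardinal.lift.{1} κ := by simpa using hunc
  refine ⟨union_subset hx.1 (union_subset ?_ (iUnion_subset fun b a ha => ?_)), ?_⟩
  · rintro _ ⟨s, rfl⟩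
    refine hF _ fun o ho => ?_
    obtain ⟨a, -, rfl⟩ := List.mem_map.1 ho
    exact hx.1 a.2
  · exact hA (mem_Iio.2 (lt_trans (mem_Iio.1 ha) (mem_Iio.1 b.2.2)))
  · refine (Cardinal.mk_union_le _ _).trans_lt (Cardinal.add_lt_of_lt hregl.aleph0_le hx.2 ?_)
    refine (Cardinal.mk_union_le _ _).trans_lt (Cardinal.add_lt_of_lt hregl.aleph0_le ?_ ?_)
    · refine Cardinal.mk_range_le.trans_lt ((Cardinal.mk_list_le_max _).trans_lt ?_)
      exact max_lt huncl hx.2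
    · refine (Cardinal.card_iUnion_lt_iff_forall_of_isRegular hregl ?_).2 fun b => ?_
      · exact (Cardinal.mk_le_mk_of_subset inter_subset_left).trans_lt hx.2
      · rw [Cardinal.mk_Iio_ordinal, Cardinal.lift_lt]
        exact Cardinal.lt_ord.1 b.2.2

lemma subset_closureStep (κ : Cardinal.{0}) (F : List Ordinal.{0} → Ordinal.{0})
    (x : Set Ordinal.{0}) : x ⊆ closureStep κ F x :=
  subset_union_left

lemma apply_mem_closureStep (κ : Cardinal.{0}) (F : List Ordinal.{0} → Ordinal.{0})
    {x : Set Ordinal.{0}} {s : List Ordinal.{0}} (hs : ∀ o ∈ s, o ∈ x) :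
    F s ∈ closureStep κ F x := by
  refine Or.inr (Or.inl ?_)
  lift s to List x using hs
  exact ⟨s, rfl⟩

lemma Iio_subset_closureStep {κ : Cardinal.{0}} (F : List Ordinal.{0} → Ordinal.{0})
    {x : Set Ordinal.{0}} {b : Ordinal.{0}} (hb : b ∈ x) (hbκ : b < κ.ord) :
    Iio b ⊆ closureStep κ F x := fun _ ha =>
  Or.inr (Or.inr (mem_iUnion.2 ⟨⟨b, hb, hbκ⟩, ha⟩))

lemma closureStep_subset_of_mem_CF {κ : Cardinal.{0}} {A : Set Ordinal.{0}}
    {F : List Ordinal.{0} → Ordinal.{0}} {x : Set Ordinal.{0}} (hx : x ∈ CF κ A F) :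
    closureStep κ F x ⊆ x := by
  refine union_subset subset_rfl (union_subset ?_ (iUnion_subset fun b => ?_))
  · rintro _ ⟨s, rfl⟩
    refine hx.2.2 _ fun o ho => ?_
    obtain ⟨a, -, rfl⟩ := List.mem_map.1 ho
    exact a.2
  · exact (exists_inter_Iio_ord_eq_iff hx.1.2).1 hx.2.1 b b.2.1 b.2.2

/-- A directed union of fewer than `κ` sets that absorbs `closureStep` lies in `C_F`. -/
lemma iUnion_mem_CF {κ : Cardinal.{0}} (hreg : κ.IsRegular) {A : Set Ordinal.{0}}
    {F : List Ordinal.{0} → Ordinal.{0}} {ι : Type 1} [Nonempty ι]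
    (hι : #ι < Cardinal.lift.{1} κ) {f : ι → Set Ordinal.{0}} (hf : Directed (· ⊆ ·) f)
    (hmem : ∀ i, f i ∈ PSet κ A) (hstep : ∀ i, ∃ j, closureStep κ F (f i) ⊆ f j) :
    (⋃ i, f i) ∈ CF κ A F := by
  have hP : (⋃ i, f i) ∈ PSet κ A :=
    ⟨iUnion_subset fun i => (hmem i).1,
      (Cardinal.card_iUnion_lt_iff_forall_of_isRegular hreg.lift hι).2 fun i => (hmem i).2⟩
  refine ⟨hP, (exists_inter_Iio_ord_eq_iff hP.2).2 fun b hb hbκ => ?_, fun s hs => ?_⟩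
  · obtain ⟨i, hi⟩ := mem_iUnion.1 hb
    obtain ⟨j, hj⟩ := hstep i
    exact ((Iio_subset_closureStep F hi hbκ).trans hj).trans (subset_iUnion f j)
  · obtain ⟨i, hi⟩ := exists_forall_mem_of_forall_mem_iUnion hf s hs
    obtain ⟨j, hj⟩ := hstep i
    exact mem_iUnion.2 ⟨j, hj (apply_mem_closureStep κ F hi)⟩

theorem isClub_CF {κ : Cardinal.{0}} (hreg : κ.IsRegular) (hunc : ℵ₀ < κ)
    {A : Set Ordinal.{0}} (hA : Iio κ.ord ⊆ A) {F : List Ordinal.{0} → Ordinal.{0}}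
    (hF : ∀ s : List Ordinal.{0}, (∀ o ∈ s, o ∈ A) → F s ∈ A) : IsClub κ A (CF κ A F) := by
  refine ⟨fun x hx => hx.1, fun x hx => ?_, fun δ hδ hδκ f hf hfC => ?_⟩
  · let g : ULift.{1} ℕ → Set Ordinal.{0} := fun n => (closureStep κ F)^[n.down] x
    have hg : ∀ n, g ⟨n + 1⟩ = closureStep κ F (g ⟨n⟩) := fun n =>
      Function.iterate_succ_apply' _ _ _
    have hmono : Monotone fun n : ℕ => g ⟨n⟩ :=
      monotone_nat_of_le_succ fun n => (hg n).symm ▸ subset_closureStep κ F _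
    refine ⟨⋃ n, g n, iUnion_mem_CF hreg (by simpa using hunc) ?_ ?_ ?_,
      subset_iUnion g ⟨0⟩⟩
    · rintro ⟨m⟩ ⟨n⟩
      exact ⟨⟨max m n⟩, hmono (le_max_left m n), hmono (le_max_right m n)⟩
    · rintro ⟨n⟩
      induction n with
      | zero => exact hx
      | succ n ih => exact hg n ▸ closureStep_mem_PSet hreg hunc hA hF ih
    · rintro ⟨n⟩
      exact ⟨⟨n + 1⟩, (hg n).ge⟩
  · rw [biUnion_eq_iUnion]
    have : Nonempty (Iio δ) := ⟨⟨0, hδ⟩⟩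
    refine iUnion_mem_CF hreg ?_ ?_ (fun i => (hfC i i.2).1)
      fun i => ⟨i, closureStep_subset_of_mem_CF (hfC i i.2)⟩
    · rw [Cardinal.mk_Iio_ordinal, Cardinal.lift_lt]
      exact Cardinal.lt_ord.1 hδκ
    · exact Monotone.directed_le fun i j hij => hf i j hij j.2

/-- A club contains the values of a `⊆`-monotone map `y` on finite subsets of `A` with
`e ⊆ y e`. -/
lemma IsClub.exists_monotone_hull {κ : Cardinal.{0}} (hreg : κ.IsRegular) {A : Set Ordinal.{0}}
    {C : Set (Set Ordinal.{0})} (hC : IsClub κ A C) :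
    ∃ y : Finset Ordinal.{0} → Set Ordinal.{0}, ∀ e : Finset Ordinal.{0}, ↑e ⊆ A →
      y e ∈ C ∧ ↑e ⊆ y e ∧ ∀ t ⊆ e, y t ⊆ y e := by
  classical
  have hκl : ℵ₀ ≤ Cardinal.lift.{1} κ := hreg.lift.aleph0_le
  let H : ∀ e : Finset Ordinal.{0}, (∀ t ⊂ e, Set Ordinal.{0}) → Set Ordinal.{0} := fun e ih =>
    if h : ∃ w ∈ C, ↑e ∪ (⋃ t : {t // t ⊂ e}, ih t t.2) ⊆ w then h.choose else ∅
  let y : Finset Ordinal.{0} → Set Ordinal.{0} := Finset.strongInduction H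
  refine ⟨y, fun e => ?_⟩
  induction e using Finset.strongInduction with
  | H e ih =>
    intro heA
    have hex : ∃ w ∈ C, ↑e ∪ (⋃ t : {t // t ⊂ e}, y t) ⊆ w := by
      refine hC.2.1 _ ⟨union_subset heA (iUnion_subset fun t => ?_), ?_⟩
      · exact (hC.1 (ih t t.2 ((Finset.coe_subset.2 t.2.subset).trans heA)).1).1
      · refine (Cardinal.mk_union_le _ _).trans_lt (Cardinal.add_lt_of_lt hκl ?_ ?_)
        · exact (Cardinal.lt_aleph0_of_finite _).trans_le hκl
        · have hfin : Finite {t // t ⊂ e} :=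
            (e.ssubsets.finite_toSet.subset fun t ht => Finset.mem_ssubsets.2 ht).to_subtype
          have hlt : ∀ t : {t // t ⊂ e}, #(y t) < Cardinal.lift.{1} κ := fun t =>
            (hC.1 (ih t t.2 ((Finset.coe_subset.2 t.2.subset).trans heA)).1).2
          exact (Cardinal.card_iUnion_lt_iff_forall_of_isRegular hreg.lift
            ((Cardinal.lt_aleph0_of_finite _).trans_le hκl)).2 hlt
    have hy : y e = hex.choose := by
      have : y e = H e fun t _ => y t := Finset.strongInduction_eq H e
      rw [this]
      exact dif_pos hex
    have hsub := hex.choose_spec.2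
    rw [← hy] at hsub
    refine ⟨hy ▸ hex.choose_spec.1, subset_union_left.trans hsub, fun t ht => ?_⟩
    rcases ht.eq_or_ssubset with rfl | hss
    · exact subset_rfl
    · exact ((subset_iUnion (fun t : {t // t ⊂ e} => y t) ⟨t, hss⟩).trans
        subset_union_right).trans hsub

/-- If `y` is a monotone map into a club, the union of `y` over the finite subsets of any set
of size `< κ` is in the club. -/
lemma IsClub.iUnion_finset_mem {κ : Cardinal.{0}} {A : Set Ordinal.{0}}
    {C : Set (Set Ordinal.{0})} (hC : IsClub κ A C) {y : Finset Ordinal.{0} → Set Ordinal.{0}}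
    (hyC : ∀ e : Finset Ordinal.{0}, ↑e ⊆ A → y e ∈ C)
    (hy : ∀ e : Finset Ordinal.{0}, ↑e ⊆ A → ∀ t ⊆ e, y t ⊆ y e)
    {z : Set Ordinal.{0}} (hz : z ∈ PSet κ A) :
    (⋃ e : {e : Finset Ordinal.{0} // ↑e ⊆ z}, y e) ∈ C := by
  classical
  induction hc : #z using WellFoundedLT.induction generalizing z with
  | ind c ih =>
    subst hc
    rcases z.finite_or_infinite with hfin | hinf
    · lift z to Finset Ordinal.{0} using hfin
      convert hyC z hz.1
      refine subset_antisymm (iUnion_subset fun e => hy z hz.1 e (Finset.coe_subset.1 e.2)) ?_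
      exact subset_iUnion (fun e : {e : Finset Ordinal.{0} // (e : Set Ordinal.{0}) ⊆ z} => y e)
        ⟨z, subset_rfl⟩
    · obtain ⟨μ, hμκ, hμz, g, hg⟩ := exists_image_Iio_ord_eq hz.2
      have hμ : ℵ₀ ≤ μ := by
        have := Cardinal.infinite_iff.1 hinf.to_subtype
        rwa [hμz, Cardinal.aleph0_le_lift] at this
      have hlim := Cardinal.isSuccLimit_ord hμ
      have hsub : ∀ α < μ.ord, g '' Iio α ⊆ z := fun α hα =>
        hg ▸ image_mono (Iio_subset_Iio hα.le)
      have hlt : ∀ α < μ.ord, #(g '' Iio α) < #z := fun α hα => by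
        refine Cardinal.mk_image_le.trans_lt ?_
        rw [Cardinal.mk_Iio_ordinal, hμz, Cardinal.lift_lt]
        exact Cardinal.lt_ord.1 hα
      have hunion := hC.2.2 μ.ord hlim.bot_lt
        (Cardinal.ord_lt_ord.2 hμκ)
        (fun α => ⋃ e : {e : Finset Ordinal.{0} // ↑e ⊆ g '' Iio α}, y e)
        (fun α β hαβ _ => iUnion_subset fun e =>
          subset_iUnion (fun e : {e : Finset Ordinal.{0} // (e : Set Ordinal.{0}) ⊆ g '' Iio β} =>
            y e) ⟨e, e.2.trans (image_mono (Iio_subset_Iio hαβ))⟩)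
        (fun α hα => ih _ (hlt α hα) ⟨(hsub α hα).trans hz.1, (hlt α hα).trans hz.2⟩ rfl)
      convert hunion using 1
      refine subset_antisymm (iUnion_subset fun e => ?_)
        (iUnion₂_subset fun α hα => iUnion_subset fun e => ?_)
      · have : Nonempty (Iio μ.ord) := ⟨⟨0, hlim.bot_lt⟩⟩
        have hcov : (e.1 : Set Ordinal.{0}) ⊆ ⋃ α : Iio μ.ord, g '' Iio (α : Ordinal.{0}) := by
          intro o ho
          have := e.2 ho
          rw [← hg] at this
          obtain ⟨a, ha, rfl⟩ := this
          exact mem_iUnion.2 ⟨⟨Order.succ a, hlim.succ_lt ha⟩, a, Order.lt_succ a, rfl⟩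
        have hdir : Directed (· ⊆ ·) fun α : Iio μ.ord => g '' Iio (α : Ordinal.{0}) :=
          Monotone.directed_le fun i j hij => image_mono (Iio_subset_Iio hij)
        obtain ⟨α, hα⟩ := hdir.exists_mem_subset_of_finset_subset_biUnion hcov
        exact fun o ho => mem_iUnion₂.2 ⟨α, α.2, mem_iUnion.2 ⟨⟨e, hα⟩, ho⟩⟩
      · exact subset_iUnion (fun e : {e : Finset Ordinal.{0} // (e : Set Ordinal.{0}) ⊆ z} => y e)
          ⟨e, e.2.trans (hsub α hα)⟩

/-- Every subset of `A` of size `< κ` is covered by the values, at nonzero ordinals below some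
`γ < κ`, of a function into `A`. -/
lemma exists_subset_image_Ioo {κ : Cardinal.{0}} (hκ : ℵ₀ ≤ κ) {A : Set Ordinal.{0}}
    (hA : Iio κ.ord ⊆ A) {w : Set Ordinal.{0}} (hw : w ∈ PSet κ A) :
    ∃ γ < κ.ord, ∃ g : Ordinal.{0} → Ordinal.{0}, (∀ a, g a ∈ A) ∧ w ⊆ g '' Ioo 0 γ := by
  classical
  obtain ⟨μ, hμκ, -, g, rfl⟩ := exists_image_Iio_ord_eq hw.2
  have h0 : (0 : Ordinal.{0}) ∈ A := hA (Cardinal.isSuccLimit_ord hκ).bot_lt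
  refine ⟨1 + μ.ord, ?_, fun a => if g (a - 1) ∈ A then g (a - 1) else 0, fun a => ?_, ?_⟩
  · rw [Cardinal.lt_ord, Ordinal.card_add, Cardinal.card_ord]
    exact Cardinal.add_lt_of_lt hκ (by simpa using Cardinal.one_lt_aleph0.trans_le hκ) hμκ
  · dsimp only
    split_ifs with h
    exacts [h, h0]
  · rintro _ ⟨a, ha, rfl⟩
    have hgA : g a ∈ A := hw.1 ⟨a, ha, rfl⟩
    exact ⟨1 + a, ⟨zero_lt_one.trans_le le_self_add, by simpa using ha⟩, by simp [hgA]⟩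

theorem IsClub.exists_CF_subset {κ : Cardinal.{0}} (hreg : κ.IsRegular) {A : Set Ordinal.{0}}
    (hA : Iio κ.ord ⊆ A) {C : Set (Set Ordinal.{0})} (hC : IsClub κ A C) :
    ∃ F : List Ordinal.{0} → Ordinal.{0},
      (∀ s : List Ordinal.{0}, (∀ o ∈ s, o ∈ A) → F s ∈ A) ∧ CF κ A F ⊆ C := by
  classical
  obtain ⟨y, hy⟩ := hC.exists_monotone_hull hreg
  have hcode : ∀ e : Finset Ordinal.{0}, ∃ p : Ordinal.{0} × (Ordinal.{0} → Ordinal.{0}),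
      ↑e ⊆ A → p.1 < κ.ord ∧ (∀ a, p.2 a ∈ A) ∧ y e ⊆ p.2 '' Ioo 0 p.1 := by
    intro e
    by_cases he : ↑e ⊆ A
    · obtain ⟨γ, hγ, g, hg⟩ := exists_subset_image_Ioo hreg.aleph0_le hA (hC.1 (hy e he).1)
      exact ⟨(γ, g), fun _ => ⟨hγ, hg⟩⟩
    · exact ⟨(0, id), fun h => absurd h he⟩
  choose p hp using hcode
  let F : List Ordinal.{0} → Ordinal.{0} := fun s => match s with
    | [] => 0
    | a :: s => if a = 0 then (p s.toFinset).1 else (p s.toFinset).2 a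
  refine ⟨F, fun s hs => ?_, fun x hx => ?_⟩
  · match s with
    | [] => exact hA hreg.ord_pos
    | a :: s =>
      have hps := hp s.toFinset fun o ho =>
        hs o (List.mem_cons_of_mem _ (List.mem_toFinset.1 ho))
      change (if a = 0 then _ else _) ∈ A
      split_ifs
      · exact hA hps.1
      · exact hps.2.1 a
  · have hlow := (exists_inter_Iio_ord_eq_iff hx.1.2).1 hx.2.1
    have h0x : (0 : Ordinal.{0}) ∈ x := hx.2.2 [] (by simp)
    have hyx : ∀ e : Finset Ordinal.{0}, ↑e ⊆ x → y e ⊆ x := by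
      intro e hex b hb
      obtain ⟨hγ, -, hcov⟩ := hp e (hex.trans hx.1.1)
      have hF : ∀ a ∈ x, F (a :: e.toList) ∈ x := fun a ha =>
        hx.2.2 _ (List.forall_mem_cons.2 ⟨ha, fun o ho => hex (Finset.mem_toList.1 ho)⟩)
      have hγx : (p e).1 ∈ x := by simpa [F] using hF 0 h0x
      obtain ⟨a, ha, rfl⟩ := hcov hb
      simpa [F, ha.1.ne'] using hF a (hlow _ hγx hγ ha.2)
    convert hC.iUnion_finset_mem (fun e he => (hy e he).1) (fun e he => (hy e he).2.2) hx.1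
    refine subset_antisymm (fun a ha => mem_iUnion.2 ⟨⟨{a}, by simpa using ha⟩, ?_⟩)
      (iUnion_subset fun e => hyx e e.2)
    exact (hy {a} (by simpa using hx.1.1 ha)).2.1 (by simp)

/-- Kueker's theorem: each `C_F` is closed unbounded in `𝒫_κ A`, every closed
unbounded `C ⊆ 𝒫_κ A` contains some `C_F`, and consequently `S ⊆ 𝒫_κ A` is
stationary iff for every `F : A^{<ω} → A` there is an `x ∈ S` with `x ∩ κ ∈ κ`
closed under `F`. -/
theorem stmt11 (κ : Cardinal.{0}) (hreg : κ.IsRegular) (hunc : ℵ₀ < κ)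
    (A : Set Ordinal.{0}) (hA : Iio κ.ord ⊆ A) :
    (∀ F : List Ordinal.{0} → Ordinal.{0},
      (∀ s : List Ordinal.{0}, (∀ o ∈ s, o ∈ A) → F s ∈ A) → IsClub κ A (CF κ A F)) ∧
    (∀ C, IsClub κ A C → ∃ F : List Ordinal.{0} → Ordinal.{0},
      (∀ s : List Ordinal.{0}, (∀ o ∈ s, o ∈ A) → F s ∈ A) ∧ CF κ A F ⊆ C) ∧
    (∀ S ⊆ PSet κ A, (IsStationary κ A S ↔
      ∀ F : List Ordinal.{0} → Ordinal.{0},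
        (∀ s : List Ordinal.{0}, (∀ o ∈ s, o ∈ A) → F s ∈ A) →
        ∃ x ∈ S, (∃ δ : Ordinal.{0}, δ < κ.ord ∧ x ∩ Iio κ.ord = Iio δ) ∧
          ∀ s : List Ordinal.{0}, (∀ o ∈ s, o ∈ x) → F s ∈ x)) := by
  have hclub := fun F => isClub_CF (F := F) hreg hunc hA
  refine ⟨hclub, fun C hC => hC.exists_CF_subset hreg hA, fun S hS => ⟨fun h F hF => ?_,
    fun h C hC => ?_⟩⟩
  · obtain ⟨x, hxS, hx⟩ := h _ (hclub F hF)
    exact ⟨x, hxS, hx.2⟩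
  · obtain ⟨F, hF, hFC⟩ := hC.exists_CF_subset hreg hA
    obtain ⟨x, hxS, hx⟩ := h F hF
    exact ⟨x, hxS, hFC ⟨hS hxS, hx⟩⟩

end PKL
end

section
/- Let κ be an inaccessible cardinal and let S be a stationary subset of E_0. For every function F : (κ⁺)^{<ω} → κ⁺ there exist a set a ∈ S with a closed under F, an ordinal δ = cf(κ_a), and a ⊆-increasing sequence ⟨a_α : α < δ⟩ of sets such that each a_α ⊆ κ⁺ has cardinality < κ_a, each a_α is closed under F, and a = ⋃_{α<δ} a_α. -/
open Cardinal Set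

namespace PKL

/-- `x` is closed under the set-valued operation `T` on finite sequences. -/
def ListClosed {α : Type*} (T : List α → Set α) (x : Set α) : Prop :=
  ∀ s : List α, (∀ o ∈ s, o ∈ x) → T s ⊆ x

/-- One step towards closing `x` under `T`. -/
def listStep {α : Type*} (T : List α → Set α) (x : Set α) : Set α :=
  x ∪ ⋃ s : List x, T (s.map Subtype.val)

/-- The smallest superset of `x` closed under `T`. -/
def listClosure {α : Type*} (T : List α → Set α) (x : Set α) : Set α :=
  ⋃ n : ℕ, (listStep T)^[n] x

section listClosure

variable {α : Type*} {T : List α → Set α} {x y : Set α}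

theorem subset_listStep : x ⊆ listStep T x := subset_union_left

theorem subset_listStep_of_forall_mem (s : List α) (hs : ∀ o ∈ s, o ∈ x) :
    T s ⊆ listStep T x := by
  lift s to List x using hs
  exact (subset_iUnion (fun s : List x => T (s.map Subtype.val)) s).trans subset_union_right

theorem listStep_subset (hy : ListClosed T y) (hxy : x ⊆ y) : listStep T x ⊆ y := by
  refine union_subset hxy (iUnion_subset fun s => hy _ fun o ho => ?_)
  obtain ⟨o', -, rfl⟩ := List.mem_map.1 ho
  exact hxy o'.2

theorem subset_listClosure : x ⊆ listClosure T x :=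
  subset_iUnion (fun n : ℕ => (listStep T)^[n] x) 0

theorem listClosure_subset (hy : ListClosed T y) (hxy : x ⊆ y) : listClosure T x ⊆ y := by
  refine iUnion_subset fun n => ?_
  induction n with
  | zero => exact hxy
  | succ n ih =>
    rw [Function.iterate_succ_apply']
    exact listStep_subset hy ih

/-- The union of a nonempty directed family of closed sets is closed. -/
theorem ListClosed.of_directed {ι : Type*} [Nonempty ι] {f : ι → Set α}
    (hf : Directed (· ⊆ ·) f) (h : ∀ i, ∀ s : List α, (∀ o ∈ s, o ∈ f i) → T s ⊆ ⋃ j, f j) :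
    ListClosed T (⋃ i, f i) := by
  intro s hs
  have : ∃ i, ∀ o ∈ s, o ∈ f i := by
    induction s with
    | nil => exact ⟨Classical.arbitrary ι, by simp⟩
    | cons b s ih =>
      obtain ⟨i, hi⟩ := ih fun o ho => hs o (List.mem_cons_of_mem _ ho)
      obtain ⟨j, hj⟩ := mem_iUnion.1 (hs b List.mem_cons_self)
      obtain ⟨k, hik, hjk⟩ := hf i j
      refine ⟨k, fun o ho => ?_⟩
      rcases List.mem_cons.1 ho with rfl | ho
      · exact hjk hj
      · exact hik (hi o ho)
  obtain ⟨i, hi⟩ := this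
  exact h i s hi

theorem listClosed_listClosure : ListClosed T (listClosure T x) := by
  have hmono : Monotone fun n : ℕ => (listStep T)^[n] x :=
    monotone_nat_of_le_succ fun n => by
      rw [Function.iterate_succ_apply']
      exact subset_listStep
  refine ListClosed.of_directed hmono.directed_le fun n s hs => ?_
  refine Subset.trans ?_ (subset_iUnion (fun n : ℕ => (listStep T)^[n] x) (n + 1))
  rw [Function.iterate_succ_apply']
  exact subset_listStep_of_forall_mem s hs

theorem listClosure_mono (hxy : x ⊆ y) : listClosure T x ⊆ listClosure T y :=
  listClosure_subset listClosed_listClosure (hxy.trans subset_listClosure)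

theorem mk_listStep_le (hT : ∀ s, (T s).Countable) : #(listStep T x) ≤ max ℵ₀ #x := by
  refine (mk_union_le _ _).trans (add_le_of_le (le_max_left _ _) (le_max_right _ _) ?_)
  refine (mk_iUnion_le _).trans (mul_le_of_le (le_max_left _ _) (mk_list_le_max _) ?_)
  exact ciSup_le' fun s => (hT _).le_aleph0.trans (le_max_left _ _)

theorem mk_listClosure_le (hT : ∀ s, (T s).Countable) : #(listClosure T x) ≤ max ℵ₀ #x := by
  have hn : ∀ n : ℕ, #((listStep T)^[n] x : Set α) ≤ max ℵ₀ #x := fun n => by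
    induction n with
    | zero => exact le_max_right _ _
    | succ n ih =>
      rw [Function.iterate_succ_apply']
      exact (mk_listStep_le hT).trans (max_le (le_max_left _ _) ih)
  have h := mk_iUnion_le_lift fun n : ℕ => (listStep T)^[n] x
  simp only [lift_uzero, mk_nat, lift_aleph0] at h
  exact h.trans (mul_le_of_le (le_max_left _ _) (le_max_left _ _) (ciSup_le' hn))

end listClosure

theorem isClub_listClosed {κ : Cardinal.{0}} (hκ : κ.IsRegular) (hκ₀ : ℵ₀ < κ)
    {A : Set Ordinal.{0}} {T : List Ordinal.{0} → Set Ordinal.{0}}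
    (hT : ∀ s, (T s).Countable) (hA : ListClosed T A) :
    IsClub κ A {x | x ∈ PSet κ A ∧ ListClosed T x} := by
  refine ⟨fun x hx => hx.1, fun x hx => ⟨listClosure T x, ⟨⟨listClosure_subset hA hx.1, ?_⟩,
    listClosed_listClosure⟩, subset_listClosure⟩, ?_⟩
  · exact (mk_listClosure_le hT).trans_lt (max_lt (aleph0_lt_lift.2 hκ₀) hx.2)
  · intro δ hδ₀ hδ f hf hfC
    refine ⟨⟨iUnion₂_subset fun α hα => (hfC α hα).1.1, ?_⟩, ?_⟩
    · refine (card_biUnion_lt_iff_forall_of_isRegular hκ.lift ?_).2 fun α hα => (hfC α hα).1.2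
      rw [mk_Iio_ordinal, lift_lt]
      exact lt_ord.1 hδ
    · rw [biUnion_eq_iUnion]
      have : Nonempty (Iio δ) := ⟨⟨0, hδ₀⟩⟩
      have hmono : Monotone fun i : Iio δ => f i := fun i j hij => hf i j hij j.2
      exact ListClosed.of_directed hmono.directed_le fun i s hs =>
        ((hfC i i.2).2 s hs).trans (subset_iUnion (fun i : Iio δ => f i) i)

/-- Every `α < κ⁺` carries an enumeration `p α` of `[0, α]` in type `κ`, with right inverse `q α`. -/
theorem exists_enumeration {κ : Cardinal.{0}} (hκ : ℵ₀ ≤ κ) :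
    ∃ p q : Ordinal.{0} → Ordinal.{0} → Ordinal.{0},
      (∀ α ξ, p α ξ ≤ α) ∧ (∀ α x, q α x < κ.ord) ∧
      ∀ α < succOrd κ, ∀ x ≤ α, p α (q α x) = x := by
  have hκ₀ : (0 : Ordinal) < κ.ord :=
    lt_ord.2 (by simpa using aleph0_pos.trans_le hκ)
  have key : ∀ α : Ordinal.{0}, ∃ p q : Ordinal.{0} → Ordinal.{0},
      (∀ ξ, p ξ ≤ α) ∧ (∀ x, q x < κ.ord) ∧ (α < succOrd κ → ∀ x ≤ α, p (q x) = x) := by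
    intro α
    by_cases hα : α < succOrd κ
    · have hcard : #(Iio (Order.succ α)) ≤ #(Iio κ.ord) := by
        rw [mk_Iio_ordinal, mk_Iio_ordinal, lift_le, card_ord]
        refine Order.lt_succ_iff.1 (lt_ord.1 ?_)
        exact (isSuccLimit_ord (hκ.trans (Order.le_succ κ))).succ_lt hα
      obtain ⟨e⟩ := hcard
      have : Nonempty (Iio (Order.succ α)) := ⟨⟨α, Order.lt_succ α⟩⟩
      classical
      refine ⟨fun ξ => if h : ξ ∈ Iio κ.ord then (Function.invFun e ⟨ξ, h⟩).1 else 0,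
        fun x => if h : x ≤ α then (e ⟨x, Order.lt_succ_of_le h⟩).1 else 0, fun ξ => ?_, fun x => ?_,
        fun _ x hx => ?_⟩
      · dsimp only
        split_ifs
        · exact Order.lt_succ_iff.1 (Function.invFun e _).2
        · exact zero_le
      · dsimp only
        split_ifs
        · exact (e _).2
        · exact hκ₀
      · have h := (e ⟨x, Order.lt_succ_of_le hx⟩).2
        simp only [hx, dif_pos]
        rw [dif_pos h, Subtype.coe_eta, Function.leftInverse_invFun e.injective]
    · exact ⟨fun _ => 0, fun _ => 0, fun _ => zero_le, fun _ => hκ₀, fun h => (hα h).elim⟩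
  choose p q hp hq hpq using key
  exact ⟨p, q, hp, hq, hpq⟩

/-- A set of ordinals has a cofinal sequence indexed by the initial ordinal of its cofinality. -/
theorem exists_cofinal_sequence {s : Set Ordinal.{0}} {c : Cardinal.{0}} (hc : c ≠ 0)
    (hs : Order.cof s = Cardinal.lift.{1} c) :
    ∃ f : Ordinal.{0} → Ordinal.{0}, (∀ i, f i ∈ s) ∧ ∀ x ∈ s, ∃ i < c.ord, x ≤ f i := by
  obtain ⟨t, ht, htc⟩ := Order.exists_cof_eq s
  have hcard : #t = #(Iio c.ord) := by rw [htc, hs, mk_Iio_ordinal, card_ord]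
  obtain ⟨e⟩ := Cardinal.eq.1 hcard
  have h₀ : (0 : Ordinal) < c.ord := lt_ord.2 (by simpa using pos_iff_ne_zero.2 hc)
  classical
  refine ⟨fun i => if h : i ∈ Iio c.ord then (e.symm ⟨i, h⟩ : t).1.1 else (e.symm ⟨0, h₀⟩ : t).1.1,
    fun i => ?_, fun x hx => ?_⟩
  · dsimp only
    split_ifs
    · exact (e.symm _).1.2
    · exact (e.symm _).1.2
  · obtain ⟨y, hy, hxy⟩ := ht ⟨x, hx⟩
    refine ⟨e ⟨y, hy⟩, (e ⟨y, hy⟩).2, ?_⟩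
    have h : (e ⟨y, hy⟩ : Ordinal) ∈ Iio c.ord := (e ⟨y, hy⟩).2
    dsimp only
    rw [dif_pos h, Subtype.coe_eta, Equiv.symm_apply_apply]
    exact hxy

/-- Fewer than `cof δ` many ordinals below `δ` are bounded by some `b < δ`. -/
theorem exists_bound_of_lt_ord_cof {δ k : Ordinal.{0}} (hk : k < δ.cof.ord)
    {f : Ordinal.{0} → Ordinal.{0}} (hf : ∀ i, f i < δ) : ∃ b < δ, ∀ i < k, f i < b := by
  have h : ¬ IsCofinal ((fun i => (⟨f i, hf i⟩ : Iio δ)) '' Iio k) := fun h => by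
    have := (Order.cof_le h).trans mk_image_le
    rw [Ordinal.cof_Iio, ← Ordinal.lift_cof, mk_Iio_ordinal, lift_le] at this
    exact (lt_ord.1 hk).not_ge this
  obtain ⟨b, hb⟩ := not_isCofinal_iff.1 h
  exact ⟨b, b.2, fun i hi => hb _ (mem_image_of_mem _ hi)⟩

/-- If `a` is closed under `T` and covered by the `p α`-images of `Iio δ` for `α ∈ a`, and `a` and
`δ` have the same cofinality, then `a` is an increasing union of length `cof δ` of sets closed
under `T` of cardinality less than `δ`. -/
theorem exists_filtration {a : Set Ordinal.{0}} {δ : Ordinal.{0}} (hδ : δ.card.ord = δ)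
    (hδ₀ : ℵ₀ < δ.card) (hcof : Cardinal.lift.{1} δ.cof = Order.cof a)
    {T : List Ordinal.{0} → Set Ordinal.{0}} (hT : ∀ s, (T s).Countable) (ha : ListClosed T a)
    {p q : Ordinal.{0} → Ordinal.{0} → Ordinal.{0}}
    (hp : ∀ α ∈ a, ∀ ξ < δ, p α ξ ∈ a) (hq : ∀ α ∈ a, ∀ x ∈ a, x ≤ α → q α x < δ)
    (hpq : ∀ α ∈ a, ∀ x ∈ a, x ≤ α → p α (q α x) = x) :
    ∃ g : Ordinal.{0} → Set Ordinal.{0},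
      (∀ i j, i ≤ j → g i ⊆ g j) ∧
      (∀ i < δ.cof.ord, #(g i) < Cardinal.lift.{1} δ.card ∧ ListClosed T (g i)) ∧
      a = ⋃ i ∈ Iio δ.cof.ord, g i := by
  have hδlim : Order.IsSuccLimit δ := hδ ▸ isSuccLimit_ord hδ₀.le
  have hc : ℵ₀ ≤ δ.cof := Ordinal.aleph0_le_cof_iff.2 (Ordinal.one_lt_cof_iff.2 hδlim)
  have hc₀ : δ.cof ≠ 0 := (aleph0_pos.trans_le hc).ne'
  obtain ⟨u, hu, hu'⟩ := exists_cofinal_sequence hc₀ hcof.symm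
  obtain ⟨v, hv, hv'⟩ := exists_cofinal_sequence (s := Iio δ) hc₀
    (by rw [Ordinal.cof_Iio, Ordinal.lift_cof])
  let X : Ordinal.{0} → Set Ordinal.{0} := fun k =>
    {x | ∃ i < k, ∃ j < k, ∃ ξ ≤ v j, p (u i) ξ = x}
  have hXa : ∀ k, X k ⊆ a := by
    rintro k _ ⟨i, -, j, -, ξ, hξ, rfl⟩
    exact hp _ (hu i) _ (hξ.trans_lt (hv j))
  have hXcard : ∀ k < δ.cof.ord, #(X k) < Cardinal.lift.{1} δ.card := by
    intro k hk
    obtain ⟨b, hb, hvb⟩ := exists_bound_of_lt_ord_cof hk hv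
    have hsub : X k ⊆ Set.image2 (fun i ξ => p (u i) ξ) (Iio k) (Iio b) := by
      rintro _ ⟨i, hi, j, hj, ξ, hξ, rfl⟩
      exact ⟨i, hi, ξ, hξ.trans_lt (hvb j hj), rfl⟩
    refine (mk_le_mk_of_subset hsub).trans_lt ((mk_image2_le).trans_lt ?_)
    refine mul_lt_of_lt (aleph0_le_lift.2 hδ₀.le) ?_ ?_
    · rw [mk_Iio_ordinal, lift_lt]
      exact (lt_ord.1 hk).trans_le δ.cof_le_card
    · rw [mk_Iio_ordinal, lift_lt]
      exact lt_ord.1 (hδ.symm ▸ hb)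
  refine ⟨fun k => listClosure T (X k), fun k l hkl => listClosure_mono ?_, fun k hk => ⟨?_, ?_⟩,
    Subset.antisymm (fun x hx => ?_) (iUnion₂_subset fun k _ => listClosure_subset ha (hXa k))⟩
  · rintro _ ⟨i, hi, j, hj, h⟩
    exact ⟨i, hi.trans_le hkl, j, hj.trans_le hkl, h⟩
  · exact (mk_listClosure_le hT).trans_lt (max_lt (aleph0_lt_lift.2 hδ₀) (hXcard k hk))
  · exact listClosed_listClosure
  · obtain ⟨i, hi, hxi⟩ := hu' x hx
    obtain ⟨j, hj, hqj⟩ := hv' _ (hq _ (hu i) x hx hxi)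
    refine mem_iUnion₂.2 ⟨Order.succ (max i j),
      (isSuccLimit_ord hc).succ_lt (max_lt hi hj), subset_listClosure ?_⟩
    exact ⟨i, Order.lt_succ_of_le (le_max_left _ _), j, Order.lt_succ_of_le (le_max_right _ _),
      _, hqj, hpq _ (hu i) x hx hxi⟩

/-- Lemma 2.4 (combinatorial form): if `S ⊆ E₀` is stationary then for every
`F : (κ⁺)^{<ω} → κ⁺` there are `a ∈ S` closed under `F` and a `⊆`-increasing
sequence `⟨a_α : α < cf κ_a⟩` of subsets of `κ⁺` of cardinality `< κ_a`, each
closed under `F`, with union `a`. -/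
theorem stmt13 (κ : Cardinal.{0}) (hκ : κ.IsInaccessible)
    (S : Set (Set Ordinal.{0})) (hS0 : S ⊆ E0 κ)
    (hSstat : IsStationary κ (Iio (succOrd κ)) S)
    (F : List Ordinal.{0} → Ordinal.{0})
    (hF : ∀ s : List Ordinal.{0}, (∀ o ∈ s, o < succOrd κ) → F s < succOrd κ) :
    ∃ a ∈ S, ∃ κa : Ordinal.{0}, a ∩ Iio κ.ord = Iio κa ∧
      (∀ s : List Ordinal.{0}, (∀ o ∈ s, o ∈ a) → F s ∈ a) ∧
      ∃ g : Ordinal.{0} → Set Ordinal.{0},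
        (∀ α β : Ordinal.{0}, α ≤ β → β < κa.cof.ord → g α ⊆ g β) ∧
        (∀ α < κa.cof.ord, g α ⊆ Iio (succOrd κ) ∧
          #(g α) < Cardinal.lift.{1} κa.card ∧
          ∀ s : List Ordinal.{0}, (∀ o ∈ s, o ∈ g α) → F s ∈ g α) ∧
        a = ⋃ α ∈ Set.Iio κa.cof.ord, g α := by
  have hκ₀ : ℵ₀ < κ := hκ.aleph0_lt
  obtain ⟨p, q, hp, hq, hpq⟩ := exists_enumeration hκ₀.le
  let T : List Ordinal.{0} → Set Ordinal.{0} := fun s =>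
    {F s, Ordinal.omega0, p (s.getD 0 0) (s.getD 1 0), q (s.getD 0 0) (s.getD 1 0)}
  have hT : ∀ s, (T s).Countable := fun s => (Set.toFinite (T s)).countable
  have hκsucc : κ.ord < succOrd κ := ord_lt_ord.2 (Order.lt_succ κ)
  have hω : Ordinal.omega0 < κ.ord := by
    rw [← ord_aleph0]
    exact ord_lt_ord.2 hκ₀
  have hA : ListClosed T (Iio (succOrd κ)) := by
    intro s hs
    have h₀ : s.getD 0 0 < succOrd κ := by
      cases s with
      | nil => exact zero_le.trans_lt hκsucc
      | cons o s => exact hs o List.mem_cons_self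
    rintro _ (rfl | rfl | rfl | rfl)
    · exact hF s hs
    · exact hω.trans hκsucc
    · exact (hp _ _).trans_lt h₀
    · exact (hq _ _).trans hκsucc
  obtain ⟨a, haS, ⟨haP, haT⟩⟩ :=
    hSstat _ (isClub_listClosed hκ.isRegular hκ₀ hT hA)
  obtain ⟨-, δ, hδ, ⟨hδord, -, -⟩, hcof⟩ := hS0 haS
  have hmem : ∀ x ∈ a, x < κ.ord → x < δ := fun x hx hxκ =>
    (Set.ext_iff.1 hδ x).1 ⟨hx, hxκ⟩
  have hδsub : ∀ x < δ, x ∈ a := fun x hx => ((Set.ext_iff.1 hδ x).2 hx).1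
  have hωδ : Ordinal.omega0 < δ :=
    hmem _ (haT [] (by simp) (by simp [T])) hω
  have hδ₀ : ℵ₀ < δ.card := by
    rwa [← ord_lt_ord, hδord, ord_aleph0]
  have hpa : ∀ α ∈ a, ∀ ξ ∈ a, p α ξ ∈ a := fun α hα ξ hξ =>
    haT [α, ξ] (by simp [hα, hξ]) (by simp [T])
  have hqa : ∀ α ∈ a, ∀ ξ ∈ a, q α ξ ∈ a := fun α hα ξ hξ =>
    haT [α, ξ] (by simp [hα, hξ]) (by simp [T])
  obtain ⟨g, hgmono, hg, hga⟩ := exists_filtration hδord hδ₀ (hcof.trans (Ordinal.cof_type a)) hT haT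
    (p := p) (q := q) (fun α hα ξ hξ => hpa α hα ξ (hδsub ξ hξ))
    (fun α hα x hx _ => hmem _ (hqa α hα x hx) (hq α x))
    (fun α hα x _ hxα => hpq α (haP.1 hα) x hxα)
  refine ⟨a, haS, δ, hδ, fun s hs => haT s hs (by simp [T]), g, fun i j hij _ => hgmono i j hij,
    fun i hi => ⟨fun x hx => haP.1 ?_, (hg i hi).1, fun s hs => (hg i hi).2 s hs (by simp [T])⟩, hga⟩
  rw [hga]
  exact mem_iUnion₂.2 ⟨i, hi, hx⟩

end PKL
end
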